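/- Let n ≥ 2, β > -2/n, a ≥ 0, and let h : ℝⁿ → ℝ be measurable, a-homogeneous (h(sλ) = s^a h(λ) for all s > 0), and GβE-integrable. Let F : [0,∞) → ℝ be bounded measurable, and let θ ~ Gamma((d(β,n)+a)/2, 1). Then ⟨h(λ) F(p₂(λ)/2)⟩_{β,n} = ⟨h(λ)⟩_{β,n} · E[F(θ)], where ⟨·⟩_{β,n} is the GβE expectation. -/

import Mathlib

open MeasureTheory ProbabilityTheory Real

open Set Metric Module in
/-- Polar coordinates separate the integral of a positively homogeneous function times a radial
function. -/
lemma integral_homogeneous_mul_fun_norm {E : Type*} [NormedAddCommGroup E] [NormedSpace ℝ E]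
    [MeasurableSpace E] [BorelSpace E] [FiniteDimensional ℝ E] [Nontrivial E]
    (μ : Measure E) [μ.IsAddHaarMeasure] {γ : ℝ} {G : E → ℝ}
    (hG : ∀ r : ℝ, 0 < r → ∀ x, G (r • x) = r ^ γ * G x) (φ : ℝ → ℝ) :
    ∫ x, G x * φ ‖x‖ ∂μ = (∫ x : sphere (0 : E) 1, G x ∂μ.toSphere) *
      ∫ r in Ioi (0 : ℝ), r ^ (finrank ℝ E - 1) * (r ^ γ * φ r) :=
  calc
    ∫ x, G x * φ ‖x‖ ∂μ = ∫ x : ({(0)}ᶜ : Set E), G x.1 * φ ‖x.1‖ ∂(μ.comap (↑)) := by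
      rw [integral_subtype_comap (measurableSet_singleton _).compl fun x ↦ G x * φ ‖x‖,
        restrict_compl_singleton]
    _ = ∫ z : sphere (0 : E) 1 × Ioi (0 : ℝ), G z.1 * ((z.2 : ℝ) ^ γ * φ z.2)
          ∂μ.toSphere.prod (.volumeIoiPow (finrank ℝ E - 1)) := by
      rw [← μ.measurePreserving_homeomorphUnitSphereProd.integral_comp
        (Homeomorph.measurableEmbedding _)]
      refine integral_congr_ae (.of_forall fun x ↦ ?_)
      have hx : 0 < ‖(x : E)‖ := norm_pos_iff.2 x.2
      have h := hG ‖(x : E)‖ hx (‖(x : E)‖⁻¹ • (x : E))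
      rw [smul_inv_smul₀ hx.ne'] at h
      simp only [homeomorphUnitSphereProd_apply_snd_coe, homeomorphUnitSphereProd_apply_fst_coe]
      rw [h]
      ring
    _ = (∫ x : sphere (0 : E) 1, G x ∂μ.toSphere) *
          ∫ r : Ioi (0 : ℝ), (r : ℝ) ^ γ * φ r ∂.volumeIoiPow (finrank ℝ E - 1) :=
      integral_prod_mul (fun x : sphere (0 : E) 1 ↦ G x)
        (fun r : Ioi (0 : ℝ) ↦ (r : ℝ) ^ γ * φ r)
    _ = _ := by
      congr 1
      simp only [Measure.volumeIoiPow, ENNReal.ofReal]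
      rw [integral_withDensity_eq_integral_smul,
        integral_subtype_comap measurableSet_Ioi
          fun a ↦ Real.toNNReal (a ^ (finrank ℝ E - 1)) • (a ^ γ * φ a),
        setIntegral_congr_fun measurableSet_Ioi fun x hx ↦ ?_]
      · rw [NNReal.smul_def, Real.coe_toNNReal _ (pow_nonneg hx.out.le _), smul_eq_mul]
      · exact (measurable_subtype_coe.pow_const _).real_toNNReal

/-- The substitution `t = r ^ 2 / 2` in a Mellin-type integral. -/
lemma integral_rpow_mul_comp_sq_div_two (κ : ℝ) (f : ℝ → ℝ) :
    ∫ r in Set.Ioi (0 : ℝ), r ^ (2 * κ - 1) * f (r ^ 2 / 2) =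
      2 ^ (κ - 1) * ∫ t in Set.Ioi (0 : ℝ), t ^ (κ - 1) * f t := by
  have hscale := integral_comp_mul_left_Ioi' (fun t ↦ t ^ (κ - 1) * f t) 0 (b := 1 / 2)
    (by norm_num)
  rw [mul_zero] at hscale
  rw [← hscale, ← integral_comp_rpow_Ioi_of_pos (p := 2)
    (g := fun t ↦ (1 / 2 * t) ^ (κ - 1) * f (1 / 2 * t)) two_pos, smul_eq_mul,
    ← integral_const_mul, ← integral_const_mul]
  refine setIntegral_congr_fun measurableSet_Ioi fun r (hr : 0 < r) ↦ ?_
  have h1 : r ^ (2 * κ - 1) = r * (r ^ 2) ^ (κ - 1) := by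
    rw [← rpow_natCast r 2, ← rpow_mul hr.le, show 2 * κ - 1 = 1 + (2 : ℕ) * (κ - 1) by
      push_cast; ring, rpow_add hr, rpow_one]
  have h2 : (2 : ℝ) ^ (κ - 1) * (1 / 2 * r ^ 2) ^ (κ - 1) = (r ^ 2) ^ (κ - 1) := by
    rw [← mul_rpow (by norm_num) (by positivity)]
    ring_nf
  have h3 : r ^ 2 / 2 = 1 / 2 * r ^ 2 := by ring
  simp only [smul_eq_mul, rpow_two]
  rw [h1, ← h2, h3, show (2 : ℝ) - 1 = 1 by norm_num, rpow_one]
  ring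

lemma integral_gammaMeasure_one {κ : ℝ} (hκ : 0 < κ) (F : ℝ → ℝ) :
    ∫ t, F t ∂gammaMeasure κ 1 =
      (Gamma κ)⁻¹ * ∫ t in Set.Ioi (0 : ℝ), t ^ (κ - 1) * (exp (-t) * F t) := by
  rw [gammaMeasure, integral_withDensity_eq_integral_toReal_smul
    (f := gammaPDF κ 1) (measurable_gammaPDFReal κ 1).ennreal_ofReal
    (.of_forall fun _ ↦ ENNReal.ofReal_lt_top), ← integral_Ici_eq_integral_Ioi,
    ← integral_const_mul, ← integral_indicator measurableSet_Ici]
  refine integral_congr_ae (.of_forall fun t ↦ ?_)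
  dsimp only
  rw [gammaPDF, ENNReal.toReal_ofReal (gammaPDFReal_nonneg hκ one_pos t)]
  simp only [gammaPDFReal, Set.indicator_apply, Set.mem_Ici, smul_eq_mul, one_rpow, one_mul]
  split_ifs
  · ring
  · simp

/-- Under a positively homogeneous weight against the standard Gaussian, `∑ j, l j ^ 2 / 2` behaves
like an independent Gamma variable. -/
lemma integral_homogeneous_mul_exp_mul_comp_sum_sq {n : ℕ} (hn : 0 < n) {γ : ℝ}
    (hγ : 0 < n + γ) {G : (Fin n → ℝ) → ℝ}
    (hG : ∀ r : ℝ, 0 < r → ∀ l, G (fun j ↦ r * l j) = r ^ γ * G l) (F : ℝ → ℝ) :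
    ∫ l, G l * (exp (-(∑ j, l j ^ 2) / 2) * F ((∑ j, l j ^ 2) / 2)) =
      (∫ l, G l * exp (-(∑ j, l j ^ 2) / 2)) * ∫ t, F t ∂gammaMeasure ((n + γ) / 2) 1 := by
  have : Nonempty (Fin n) := ⟨⟨0, hn⟩⟩
  set κ : ℝ := (n + γ) / 2 with hκdef
  have hκ : 0 < κ := by positivity
  obtain ⟨S, hS⟩ : ∃ S : ℝ, ∀ F : ℝ → ℝ,
      ∫ l, G l * (exp (-(∑ j, l j ^ 2) / 2) * F ((∑ j, l j ^ 2) / 2)) =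
        S * ∫ t, F t ∂gammaMeasure κ 1 := by
    refine ⟨(∫ x : Metric.sphere (0 : EuclideanSpace ℝ (Fin n)) 1, G x.1.ofLp
      ∂(volume : Measure (EuclideanSpace ℝ (Fin n))).toSphere) * (2 ^ (κ - 1) * Gamma κ),
      fun F ↦ ?_⟩
    have hpolar := integral_homogeneous_mul_fun_norm
      (volume : Measure (EuclideanSpace ℝ (Fin n))) (γ := γ) (G := fun x ↦ G x.ofLp)
      (fun r hr x ↦ hG r hr x.ofLp) (fun r ↦ exp (-(r ^ 2 / 2)) * F (r ^ 2 / 2))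
    have hradial : ∫ r in Set.Ioi (0 : ℝ), r ^ (n - 1) *
        (r ^ γ * (exp (-(r ^ 2 / 2)) * F (r ^ 2 / 2))) =
        2 ^ (κ - 1) * ∫ t in Set.Ioi (0 : ℝ), t ^ (κ - 1) * (exp (-t) * F t) := by
      rw [← integral_rpow_mul_comp_sq_div_two κ fun t ↦ exp (-t) * F t]
      refine setIntegral_congr_fun measurableSet_Ioi fun r (hr : 0 < r) ↦ ?_
      have : 2 * κ - 1 = ((n - 1 : ℕ) : ℝ) + γ := by
        rw [hκdef, Nat.cast_pred hn]
        ring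
      simp only [this, rpow_add hr, rpow_natCast]
      ring
    rw [← (PiLp.volume_preserving_ofLp (Fin n)).integral_comp
      (MeasurableEquiv.toLp 2 (Fin n → ℝ)).symm.measurableEmbedding]
    simp only [EuclideanSpace.norm_sq_eq, norm_eq_abs, sq_abs, finrank_euclideanSpace_fin]
      at hpolar
    simp only [neg_div]
    rw [hpolar, hradial, integral_gammaMeasure_one hκ]
    field_simp [(Gamma_pos_of_pos hκ).ne']
  have hone := hS fun _ ↦ 1
  have := isProbabilityMeasure_gammaMeasure hκ one_pos
  simp only [mul_one, integral_const, probReal_univ, smul_eq_mul] at hone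
  rw [hS F, hone]

/-- The absolute Vandermonde product is homogeneous of degree `n (n - 1) / 2`. -/
lemma abs_prod_sub_smul_rpow (n : ℕ) (β : ℝ) {r : ℝ} (hr : 0 < r) (l : Fin n → ℝ) :
    |∏ p ∈ Finset.univ.filter (fun p : Fin n × Fin n => p.1 < p.2),
        (r * l p.2 - r * l p.1)| ^ β =
      r ^ (n * (n - 1) * β / 2) *
        |∏ p ∈ Finset.univ.filter (fun p : Fin n × Fin n => p.1 < p.2), (l p.2 - l p.1)| ^ β := by
  have hcard : (((Finset.univ.filter fun p : Fin n × Fin n => p.1 < p.2).card : ℕ) : ℝ) =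
      n * (n - 1) / 2 := by
    rw [Fintype.card_product_filter_lt, Fintype.card_fin, Nat.cast_choose_two]
  simp only [← mul_sub, Finset.prod_mul_distrib, Finset.prod_const]
  rw [abs_mul, mul_rpow (abs_nonneg _) (abs_nonneg _), abs_of_pos (pow_pos hr _),
    ← rpow_natCast, ← rpow_mul hr.le, hcard]
  ring_nf

/-- For an `a`-homogeneous integrable function `h` and bounded measurable `F`,
`⟨h(λ) F(p₂(λ)/2)⟩_{β,n} = ⟨h(λ)⟩_{β,n} · E[F(θ)]` where `θ ~ Gamma((d(β,n)+a)/2, 1)`. -/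
theorem gbe_homogeneous_factorization (n : ℕ) (hn : 2 ≤ n) (β : ℝ) (hβ : -2 / n < β)
    (a : ℝ) (ha : 0 ≤ a)
    (Z : ℝ) (μ : Measure (Fin n → ℝ))
    (hZ : Z = ∫ l : Fin n → ℝ,
      |∏ p ∈ Finset.univ.filter (fun p : Fin n × Fin n => p.1 < p.2), (l p.2 - l p.1)| ^ β
        * Real.exp (-(∑ j, l j ^ 2) / 2))
    (hμ : μ = (volume : Measure (Fin n → ℝ)).withDensity fun l =>
      ENNReal.ofReal (Z⁻¹ *
        (|∏ p ∈ Finset.univ.filter (fun p : Fin n × Fin n => p.1 < p.2), (l p.2 - l p.1)| ^ β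
          * Real.exp (-(∑ j, l j ^ 2) / 2))))
    (h : (Fin n → ℝ) → ℝ) (hmeas : Measurable h)
    (hhom : ∀ (s : ℝ), 0 < s → ∀ l, h (fun j => s * l j) = s ^ a * h l)
    (hint : Integrable h μ)
    (F : ℝ → ℝ) (hF : Measurable F) (C : ℝ) (hFbdd : ∀ t, |F t| ≤ C) :
    ∫ l, h l * F ((∑ j, l j ^ 2) / 2) ∂μ
      = (∫ l, h l ∂μ) *
        ∫ t, F t ∂(gammaMeasure ((n + n * (n - 1) * β / 2 + a) / 2) 1) := by
  have hn0 : (0 : ℝ) < n := by positivity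
  have hn1 : (1 : ℝ) < n := by exact_mod_cast hn
  set V : (Fin n → ℝ) → ℝ := fun l ↦
    |∏ p ∈ Finset.univ.filter (fun p : Fin n × Fin n => p.1 < p.2), (l p.2 - l p.1)| ^ β with hV
  have hVmeas : Measurable V := by
    refine Measurable.pow_const (Measurable.abs ?_) β
    exact Finset.measurable_prod _ fun p _ ↦ by fun_prop
  have hVnonneg : ∀ l, 0 ≤ V l := fun l ↦ rpow_nonneg (abs_nonneg _) _
  have hZ0 : 0 ≤ Z := by
    rw [hZ]
    exact integral_nonneg fun l ↦ mul_nonneg (hVnonneg l) (exp_pos _).le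
  have hdens : ∀ g : (Fin n → ℝ) → ℝ,
      ∫ l, g l ∂μ = Z⁻¹ * ∫ l, V l * exp (-(∑ j, l j ^ 2) / 2) * g l := by
    intro g
    rw [hμ, integral_withDensity_eq_integral_toReal_smul (by fun_prop)
      (.of_forall fun _ ↦ ENNReal.ofReal_lt_top), ← integral_const_mul]
    refine integral_congr_ae (.of_forall fun l ↦ ?_)
    have : 0 ≤ Z⁻¹ * (V l * exp (-(∑ j, l j ^ 2) / 2)) :=
      mul_nonneg (inv_nonneg.2 hZ0) (mul_nonneg (hVnonneg l) (exp_pos _).le)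
    simp only [smul_eq_mul]
    rw [ENNReal.toReal_ofReal this]
    ring
  have hdeg : 0 < n + (n * (n - 1) * β / 2 + a) := by
    have h1 : -2 < β * n := (div_lt_iff₀ hn0).1 hβ
    nlinarith
  have hfactor := integral_homogeneous_mul_exp_mul_comp_sum_sq (by omega) hdeg
    (G := fun l ↦ V l * h l) (fun r hr l ↦ by
      simp only [hV, abs_prod_sub_smul_rpow n β hr l, hhom r hr l, rpow_add hr]
      ring) F
  rw [hdens, hdens, add_assoc, mul_assoc]
  congr 1
  convert hfactor using 3
  · ring
  · ext l
    ring
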